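/- Let λ > 1. Then there exist a constant C > 0 and N ∈ ℕ such that for all n ≥ N, |‖C_{n−2}^{(λ+1)}‖₂² − n^{4λ}/(4λ·Γ(2λ+1)²) − ((λ−1)/Γ(2λ+1)²)·n^{4λ−1}| ≤ C·n^{4λ−2}. -/

import Mathlib

open Real MeasureTheory Finset

/-- Gegenbauer polynomials `C_n^{(λ)}`: `C_0 = 1`, `C_1 = 2λx`, and
`n C_n(x) = 2(n+λ-1) x C_{n-1}(x) - (n+2λ-2) C_{n-2}(x)` for `n ≥ 2`. -/
noncomputable def gegenbauer (lam : ℝ) : ℕ → ℝ → ℝ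
  | 0, _ => 1
  | 1, x => 2 * lam * x
  | n + 2, x =>
      (2 * ((n : ℝ) + 1 + lam) * x * gegenbauer lam (n + 1) x
        - ((n : ℝ) + 2 * lam) * gegenbauer lam n x) / ((n : ℝ) + 2)

/-- The derivative of the Gegenbauer polynomials, by recursion. -/
noncomputable def gegD (mu : ℝ) : ℕ → ℝ → ℝ
  | 0, _ => 0
  | 1, _ => 2 * mu
  | n + 2, x =>
      (2 * ((n : ℝ) + 1 + mu) * (gegenbauer mu (n + 1) x + x * gegD mu (n + 1) x)
        - ((n : ℝ) + 2 * mu) * gegD mu n x) / ((n : ℝ) + 2)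

lemma geg_hasDerivAt (mu : ℝ) (n : ℕ) (x : ℝ) :
    HasDerivAt (gegenbauer mu n) (gegD mu n x) x ∧
    HasDerivAt (gegenbauer mu (n + 1)) (gegD mu (n + 1) x) x := by
  induction n with
  | zero =>
    constructor
    · have : gegenbauer mu 0 = fun _ => 1 := by funext x; simp [gegenbauer]
      rw [this]; simpa [gegD] using hasDerivAt_const x (1 : ℝ)
    · have : gegenbauer mu (0 + 1) = fun x => 2 * mu * x := by funext x; simp [gegenbauer]
      rw [this]; simpa [gegD] using (hasDerivAt_id x).const_mul (2 * mu)
  | succ n ih =>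
    refine ⟨ih.2, ?_⟩
    have h : gegenbauer mu (n + 1 + 1) = fun x =>
      (2 * ((n : ℝ) + 1 + mu) * x * gegenbauer mu (n + 1) x
        - ((n : ℝ) + 2 * mu) * gegenbauer mu n x) / ((n : ℝ) + 2) := by
      funext x; rw [gegenbauer]
    rw [h]
    have h1 := ((((hasDerivAt_id x).const_mul (2 * ((n : ℝ) + 1 + mu))).mul ih.2).sub
      (ih.1.const_mul ((n : ℝ) + 2 * mu))).div_const ((n : ℝ) + 2)
    refine h1.congr_deriv ?_
    rw [gegD]; simp only [id]; ring

lemma geg_rec (mu : ℝ) (n : ℕ) (x : ℝ) : ((n : ℝ) + 2) * gegenbauer mu (n + 2) x =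
    2 * ((n : ℝ) + 1 + mu) * x * gegenbauer mu (n + 1) x
        - ((n : ℝ) + 2 * mu) * gegenbauer mu n x := by
  rw [gegenbauer]; field_simp

lemma gegD_rec (mu : ℝ) (n : ℕ) (x : ℝ) : ((n : ℝ) + 2) * gegD mu (n + 2) x =
    2 * ((n : ℝ) + 1 + mu) * (gegenbauer mu (n + 1) x + x * gegD mu (n + 1) x)
        - ((n : ℝ) + 2 * mu) * gegD mu n x := by
  rw [gegD]; field_simp

lemma geg_PQ (mu : ℝ) (n : ℕ) (x : ℝ) :
    gegD mu (n + 1) x = x * gegD mu n x + (n + 2 * mu) * gegenbauer mu n x ∧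
    x * gegD mu (n + 1) x - gegD mu n x = (n + 1) * gegenbauer mu (n + 1) x := by
  induction n with
  | zero => simp [gegD, gegenbauer]; ring
  | succ n ih =>
    obtain ⟨P, Q⟩ := ih
    have hn : (n : ℝ) + 2 ≠ 0 := by positivity
    have P' : gegD mu (n + 2) x
        = x * gegD mu (n + 1) x + (n + 1 + 2 * mu) * gegenbauer mu (n + 1) x := by
      apply mul_left_cancel₀ hn
      rw [gegD_rec]
      linear_combination ((n : ℝ) + 2 * mu) * Q
    refine ⟨by push_cast; exact P', ?_⟩
    have hr := geg_rec mu n x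
    push_cast
    linear_combination x * P' - hr + x * Q - P

lemma geg_g (mu : ℝ) (n : ℕ) (x : ℝ) :
    (1 - x ^ 2) * gegD mu (n + 1) x
      = (n + 2 * mu) * gegenbauer mu n x - (n + 1) * x * gegenbauer mu (n + 1) x := by
  obtain ⟨P, Q⟩ := geg_PQ mu n x
  linear_combination P - x * Q

lemma geg_g_deriv (mu : ℝ) (n : ℕ) (x : ℝ) :
    HasDerivAt (fun x => (1 - x ^ 2) * gegD mu (n + 1) x)
      ((2 * mu - 1) * x * gegD mu (n + 1) x
        - ((n + 1) * (n + 1 + 2 * mu)) * gegenbauer mu (n + 1) x) x := by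
  have h : (fun x => (1 - x ^ 2) * gegD mu (n + 1) x) = fun x =>
      (n + 2 * mu) * gegenbauer mu n x - (n + 1) * x * gegenbauer mu (n + 1) x := by
    funext x; exact geg_g mu n x
  rw [h]
  obtain ⟨P, Q⟩ := geg_PQ mu n x
  have h1 := ((geg_hasDerivAt mu n x).1.const_mul ((n : ℝ) + 2 * mu)).sub
    (((hasDerivAt_id x).const_mul ((n : ℝ) + 1)).mul (geg_hasDerivAt mu n x).2)
  refine h1.congr_deriv ?_
  simp only [id]
  linear_combination (-(n : ℝ) - 2 * mu) * Q

/-- first exact energy identity -/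
lemma F1_deriv (l K : ℝ) (y d : ℝ → ℝ) (hy : ∀ x, HasDerivAt y (d x) x)
    (hg : ∀ x, HasDerivAt (fun x => (1 - x ^ 2) * d x) ((2 * l + 1) * x * d x - K * y x) x)
    (x : ℝ) :
    HasDerivAt (fun x => ((1 - x ^ 2) * d x) ^ 2
      - (4 * l + 2) * x * (y x * ((1 - x ^ 2) * d x))
      + ((K + 2 * l + 1) * (1 - x ^ 2) + (2 * l + 1) ^ 2 * x ^ 2) * y x ^ 2)
      (4 * l * (K + 2 * l + 1) * (x * y x ^ 2)) x := by
  have hx := hasDerivAt_id x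
  have h1 := (((hg x).pow 2).sub ((hx.const_mul (4 * l + 2)).mul ((hy x).mul (hg x)))).add
    (((((hx.pow 2).const_sub 1).const_mul (K + 2 * l + 1)).add
      ((hx.pow 2).const_mul ((2 * l + 1) ^ 2))).mul ((hy x).pow 2))
  refine h1.congr_deriv ?_
  simp
  ring

/-- coefficient in the second identity -/
noncomputable def qpoly (l x : ℝ) : ℝ :=
  -(1 / 2) * ((3 - 2 * (4 * l - 1) - (2 * l + 2))
    + (3 * (3 - 2 * l) * (4 * l - 1) - 3 * (2 - 2 * (4 * l - 1) - (2 * l + 1))) * x ^ 2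
    - 5 * (3 - 2 * l) * (4 * l - 1) * x ^ 4)

/-- second energy identity -/
lemma F2_deriv (l K : ℝ) (y d : ℝ → ℝ) (hy : ∀ x, HasDerivAt y (d x) x)
    (hg : ∀ x, HasDerivAt (fun x => (1 - x ^ 2) * d x) ((2 * l + 1) * x * d x - K * y x) x)
    (x : ℝ) :
    HasDerivAt (fun x => (x * (1 - x ^ 2)) * ((1 - x ^ 2) * d x) ^ 2
      - ((1 - x ^ 2) * (1 + (4 * l - 1) * x ^ 2)) * (y x * ((1 - x ^ 2) * d x))
      + ((1 - x ^ 2) * (K * (x * (1 - x ^ 2)) - (1 / 2) * ((2 - 2 * (4 * l - 1) - (2 * l + 1)) * x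
          + (3 - 2 * l) * (4 * l - 1) * x ^ 3))) * y x ^ 2)
      ((K * ((1 - x ^ 2) * (2 * (1 - x ^ 2) + (4 * l - 4) * x ^ 2)) + qpoly l x) * y x ^ 2) x := by
  have hx := hasDerivAt_id x
  have hw := (hx.pow 2).const_sub 1
  have h1 := (((hx.mul hw).mul ((hg x).pow 2)).sub
    ((hw.mul (((hx.pow 2).const_mul (4 * l - 1)).const_add 1)).mul ((hy x).mul (hg x)))).add
    ((hw.mul (((hx.mul hw).const_mul K).sub (((hx.const_mul (2 - 2 * (4 * l - 1) - (2 * l + 1))).add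
      ((hx.pow 3).const_mul ((3 - 2 * l) * (4 * l - 1)))).const_mul (1 / 2)))).mul ((hy x).pow 2))
  refine h1.congr_deriv ?_
  simp [qpoly]
  ring
lemma energy (l K : ℝ) (y d : ℝ → ℝ) (hy : ∀ x, HasDerivAt y (d x) x)
    (hg : ∀ x, HasDerivAt (fun x => (1 - x ^ 2) * d x) ((2 * l + 1) * x * d x - K * y x) x)
    (hK : 0 ≤ K) (Q κ : ℝ) (hQ : ∀ x ∈ Set.Icc (0:ℝ) 1, |qpoly l x| ≤ Q)
    (hκ1 : κ ≤ 2) (hκ2 : κ ≤ 4 * l - 4) :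
    ∃ W : ℝ, 4 * l * (K + 2 * l + 1) * (∫ x in (0:ℝ)..1, x * y x ^ 2)
        = (2 * l + 1) ^ 2 * y 1 ^ 2 - (d 0 ^ 2 + (K + 2 * l + 1) * y 0 ^ 2) ∧
      K * κ * W ≤ Q * (∫ x in (0:ℝ)..1, y x ^ 2) + |y 0 * d 0| ∧
      (∫ x in (0:ℝ)..1, x * y x ^ 2) ≤ ∫ x in (0:ℝ)..1, y x ^ 2 ∧
      (∫ x in (0:ℝ)..1, y x ^ 2) ≤ (∫ x in (0:ℝ)..1, x * y x ^ 2) + W := by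
  have hc : Continuous y := continuous_iff_continuousAt.2 fun x => (hy x).continuousAt
  have hqc : Continuous (qpoly l) := by unfold qpoly; fun_prop
  have ii : ∀ f : ℝ → ℝ, Continuous f → IntervalIntegrable f volume 0 1 :=
    fun f hf => hf.intervalIntegrable 0 1
  refine ⟨∫ x in (0:ℝ)..1, (1 - x ^ 2) * y x ^ 2, ?_, ?_, ?_, ?_⟩
  · have h := intervalIntegral.integral_eq_sub_of_hasDerivAt
      (fun x _ => F1_deriv l K y d hy hg x) (ii (fun x => 4 * l * (K + 2 * l + 1) * (x * y x ^ 2)) (by fun_prop))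
    rw [intervalIntegral.integral_const_mul] at h
    rw [h]; norm_num
  · have h := intervalIntegral.integral_eq_sub_of_hasDerivAt
      (fun x _ => F2_deriv l K y d hy hg x) (ii (fun x => (K * ((1 - x ^ 2) * (2 * (1 - x ^ 2) + (4 * l - 4) * x ^ 2)) + qpoly l x) * y x ^ 2) (by fun_prop))
    have h2 : (∫ x in (0:ℝ)..1, (K * κ * ((1 - x ^ 2) * y x ^ 2) - Q * y x ^ 2)) ≤
      ∫ x in (0:ℝ)..1, (K * ((1 - x ^ 2) * (2 * (1 - x ^ 2) + (4 * l - 4) * x ^ 2)) + qpoly l x) * y x ^ 2 := by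
      apply intervalIntegral.integral_mono_on zero_le_one (ii _ (by fun_prop)) (ii _ (by fun_prop))
      intro x hx
      have hq := (abs_le.1 (hQ x hx)).1
      have hw : 0 ≤ 1 - x ^ 2 := by nlinarith [hx.1, hx.2]
      have h3 : κ ≤ 2 * (1 - x ^ 2) + (4 * l - 4) * x ^ 2 := by nlinarith [sq_nonneg x]
      have h4 : K * (κ * (1 - x ^ 2)) ≤ K * ((1 - x ^ 2) * (2 * (1 - x ^ 2) + (4 * l - 4) * x ^ 2)) := by
        apply mul_le_mul_of_nonneg_left _ hK
        nlinarith
      have h5 := mul_le_mul_of_nonneg_right (add_le_add h4 hq) (sq_nonneg (y x))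
      linarith
    rw [h, intervalIntegral.integral_sub (ii _ (by fun_prop)) (ii _ (by fun_prop)), intervalIntegral.integral_const_mul, intervalIntegral.integral_const_mul] at h2
    norm_num at h2
    have := le_abs_self (y 0 * d 0)
    linarith
  · apply intervalIntegral.integral_mono_on zero_le_one (ii _ (by fun_prop)) (ii _ (by fun_prop))
    intro x hx
    nlinarith [hx.2, sq_nonneg (y x)]
  · rw [← intervalIntegral.integral_add (ii _ (by fun_prop)) (ii _ (by fun_prop))]
    apply intervalIntegral.integral_mono_on zero_le_one (ii _ (by fun_prop)) (ii _ (by fun_prop))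
    intro x hx
    have h1 : 0 ≤ x - x ^ 2 := by nlinarith [hx.1, hx.2]
    nlinarith [mul_nonneg h1 (sq_nonneg (y x))]

lemma qpoly_bound (l : ℝ) : ∃ Q : ℝ, 0 ≤ Q ∧ ∀ x ∈ Set.Icc (0:ℝ) 1, |qpoly l x| ≤ Q := by
  have hqc : Continuous (qpoly l) := by unfold qpoly; fun_prop
  obtain ⟨Q, hQ⟩ := isCompact_Icc.exists_bound_of_continuousOn (s := Set.Icc (0:ℝ) 1) hqc.continuousOn
  exact ⟨Q, (norm_nonneg _).trans (hQ 0 (by simp)), hQ⟩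

lemma geg_zero_bound (l : ℝ) (hl : 1 < l) (m : ℕ) :
    |gegenbauer (l + 1) m 0| ≤ ((m : ℝ) + 2) ^ l ∧
    |gegenbauer (l + 1) (m + 1) 0| ≤ ((m : ℝ) + 1 + 2) ^ l := by
  induction m with
  | zero =>
    constructor
    · simp [gegenbauer]; exact Real.one_le_rpow (by norm_num) (by linarith)
    · simp [gegenbauer]; positivity
  | succ m ih =>
    refine ⟨by push_cast; exact ih.2, ?_⟩
    have hr := geg_rec (l + 1) m 0
    have hm : (0:ℝ) < (m : ℝ) + 2 := by positivity
    have e : gegenbauer (l + 1) (m + 1 + 1) 0 = -((1 + l * (2 / ((m:ℝ) + 2))) * gegenbauer (l + 1) m 0) := by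
      apply mul_left_cancel₀ hm.ne'
      rw [hr]; field_simp; ring
    have h0 : (0:ℝ) ≤ 1 + l * (2 / ((m:ℝ) + 2)) := by positivity
    rw [e, abs_neg, abs_mul, abs_of_nonneg h0]
    have hB := one_add_mul_self_le_rpow_one_add (s := 2 / ((m:ℝ) + 2))
      (by have : 0 ≤ 2 / ((m:ℝ) + 2) := by positivity
          linarith) hl.le
    calc _ ≤ (1 + 2 / ((m:ℝ) + 2)) ^ l * ((m : ℝ) + 2) ^ l :=
          mul_le_mul hB ih.1 (abs_nonneg _) (by positivity)
      _ = _ := by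
          rw [← Real.mul_rpow (by positivity) hm.le]
          congr 1; push_cast; field_simp; ring

lemma telescoping (L : ℕ → ℝ) (D : ℝ) (hD : 0 ≤ D) (N : ℕ)
    (hL : Filter.Tendsto L Filter.atTop (nhds 0))
    (h : ∀ m, N ≤ m → |L (m + 1) - L m| ≤ D / ((m : ℝ) + 1) ^ 3) (m : ℕ) (hm : N ≤ m)
    (hm1 : 1 ≤ m) : |L m| ≤ D / (m : ℝ) ^ 2 := by
  have hm0 : (0:ℝ) < m := by exact_mod_cast hm1
  have key : ∀ j : ℕ, |L (m + j) - L m| ≤ D * (1 / (m:ℝ) ^ 2 - 1 / ((m:ℝ) + j) ^ 2) := by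
    intro j
    induction j with
    | zero => simp
    | succ j ih =>
      have h1 := h (m + j) (by omega)
      have h2 : D / (((m + j : ℕ) : ℝ) + 1) ^ 3 ≤
          D * (1 / ((m:ℝ) + j) ^ 2 - 1 / ((m:ℝ) + (j + 1 : ℕ)) ^ 2) := by
        rw [div_eq_mul_one_div]
        apply mul_le_mul_of_nonneg_left _ hD
        push_cast
        have hx : (0:ℝ) < (m:ℝ) + j := by positivity
        rw [← add_assoc]
        generalize (m:ℝ) + j = x at hx
        rw [div_sub_div _ _ (by positivity) (by positivity), div_le_div_iff₀ (by positivity) (by positivity)]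
        nlinarith [pow_pos hx 2, pow_pos hx 3, pow_pos hx 4]
      have h3 := abs_add_le (L (m + j + 1) - L (m + j)) (L (m + j) - L m)
      rw [sub_add_sub_cancel] at h3
      rw [← add_assoc]
      linarith
  have hlim : Filter.Tendsto (fun j => |L (m + j) - L m|) Filter.atTop (nhds |0 - L m|) := by
    apply Filter.Tendsto.abs
    apply Filter.Tendsto.sub_const
    have := (Filter.tendsto_add_atTop_iff_nat (f := L) m).2 hL
    simpa [add_comm] using this
  rw [zero_sub, abs_neg] at hlim
  refine le_of_tendsto' hlim fun j => (key j).trans ?_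
  have : 0 ≤ D * (1 / ((m:ℝ) + j) ^ 2) := by positivity
  rw [mul_sub]
  have e : D * (1 / (m:ℝ) ^ 2) = D / (m:ℝ) ^ 2 := by ring
  linarith

lemma log_lem (s a : ℝ) (hs : 0 < s) (ha : |a| ≤ s / 2) :
    |Real.log (s + a) - Real.log (s - a) - 2 * a / s| ≤ 4 * |a| ^ 3 / s ^ 3 := by
  set x := a / s with hx
  have hax : |x| ≤ 1 / 2 := by
    rw [hx, abs_div, abs_of_pos hs, div_le_iff₀ hs]; linarith
  have h1 := Real.abs_log_sub_add_sum_range_le (x := x) (by linarith) 2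
  have h2 := Real.abs_log_sub_add_sum_range_le (x := -x) (by rw [abs_neg]; linarith) 2
  rw [abs_neg] at h2
  simp [Finset.sum_range_succ] at h1 h2
  have h3 : |x| ^ 3 / (1 - |x|) ≤ 2 * |x| ^ 3 := by
    rw [div_le_iff₀ (by linarith)]
    have : 0 ≤ |x| ^ 3 := by positivity
    nlinarith
  have hb := abs_le.1 hax
  have e1 : s + a = s * (1 + x) := by rw [hx]; field_simp
  have e2 : s - a = s * (1 - x) := by rw [hx]; field_simp
  rw [e1, e2, Real.log_mul hs.ne' (by linarith), Real.log_mul hs.ne' (by linarith)]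
  have e3 : 2 * a / s = 2 * x := by rw [hx]; ring
  have e4 : 4 * |a| ^ 3 / s ^ 3 = 4 * |x| ^ 3 := by
    rw [hx, abs_div, abs_of_pos hs]; ring
  rw [e3, e4]
  have h1' := abs_le.1 (h1.trans (by simpa using h3))
  have h2' := abs_le.1 (h2.trans (by simpa using h3))
  norm_num at h1' h2'
  rw [abs_le]; constructor <;> nlinarith
lemma geg_one_rec (l : ℝ) (m : ℕ) : ((m : ℝ) + 1) * gegenbauer (l + 1) (m + 1) 1
    = (m + 2 * l + 2) * gegenbauer (l + 1) m 1 := by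
  have := geg_g (l + 1) m 1
  norm_num at this
  linarith

lemma geg_one_pos (l : ℝ) (hl : 1 < l) (m : ℕ) : 0 < gegenbauer (l + 1) m 1 := by
  induction m with
  | zero => simp [gegenbauer]
  | succ m ih =>
    have h := geg_one_rec l m
    have : 0 < ((m : ℝ) + 1) * gegenbauer (l + 1) (m + 1) 1 := by rw [h]; positivity
    exact pos_of_mul_pos_right this (by positivity)

lemma geg_one_log_succ (l : ℝ) (hl : 1 < l) (m : ℕ) :
    Real.log (gegenbauer (l + 1) (m + 1) 1) = Real.log (gegenbauer (l + 1) m 1)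
      + Real.log (m + 2 * l + 2) - Real.log (m + 1) := by
  have h := congrArg Real.log (geg_one_rec l m)
  rw [Real.log_mul (by positivity) (geg_one_pos l hl _).ne',
    Real.log_mul (by positivity) (geg_one_pos l hl _).ne'] at h
  linarith

lemma geg_one_log (l : ℝ) (hl : 1 < l) (m : ℕ) :
    Real.log (gegenbauer (l + 1) m 1) =
      (∑ j ∈ Finset.range m, Real.log (2 * l + 2 + j)) - Real.log (Nat.factorial m) := by
  induction m with
  | zero => simp [gegenbauer]
  | succ m ih =>
    rw [geg_one_log_succ l hl, ih, Finset.sum_range_succ, Nat.factorial_succ]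
    push_cast
    rw [Real.log_mul (by positivity) (by positivity)]
    rw [show (m:ℝ) + 2 * l + 2 = 2 * l + 2 + m by ring]
    ring

/-- logarithm of the normalised main term -/
noncomputable def LL (l : ℝ) (m : ℕ) : ℝ :=
  2 * Real.log (Real.Gamma (2 * l + 2)) + 2 * Real.log (gegenbauer (l + 1) m 1)
    - Real.log (m + 1) - Real.log (m + (2 * l + 1)) - 4 * l * Real.log (m + (l + 1))

lemma LL_tendsto (l : ℝ) (hl : 1 < l) : Filter.Tendsto (LL l) Filter.atTop (nhds 0) := by
  have h1 := Real.BohrMollerup.tendsto_log_gamma (x := 2 * l + 2) (by linarith)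
  have hs : ∀ c : ℝ, Filter.Tendsto (fun m : ℕ => Real.log ((m : ℝ) + c) - Real.log m) Filter.atTop (nhds 0) :=
    fun c => (Real.tendsto_log_comp_add_sub_log c).comp tendsto_natCast_atTop_atTop
  have h2 := (((((h1.const_sub (Real.log (Real.Gamma (2 * l + 2)))).const_mul 2).sub
    ((hs (2 * l + 2)).const_mul 2)).sub (hs 1)).sub (hs (2 * l + 1))).sub
      ((hs (l + 1)).const_mul (4 * l))
  simp only [sub_self, mul_zero] at h2
  refine h2.congr fun m => ?_
  rw [LL, geg_one_log l hl, Real.BohrMollerup.logGammaSeq, Finset.sum_range_succ]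
  rw [show (m:ℝ) + (2 * l + 2) = 2 * l + 2 + m by ring]
  ring

lemma LL_bound (l : ℝ) (hl : 1 < l) : ∃ D : ℝ, 0 ≤ D ∧ ∃ N : ℕ, ∀ m : ℕ, N ≤ m →
    |LL l m| ≤ D / (m : ℝ) ^ 2 := by
  set D := 4 * |l + 1 / 2| ^ 3 + 4 * |l - 1 / 2| ^ 3 + 4 * l * (4 * |(1 / 2 : ℝ)| ^ 3) with hDd
  have hD : 0 ≤ D := by positivity
  obtain ⟨N, hN⟩ := exists_nat_ge l
  refine ⟨D, hD, N + 1, fun m hm => telescoping (LL l) D hD N (LL_tendsto l hl) ?_ m (by omega) (by omega)⟩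
  clear hm m
  intro m hm
  have hml : l ≤ m := hN.trans (by exact_mod_cast hm)
  set s : ℝ := m + l + 3 / 2 with hs
  have hs0 : 0 < s := by positivity
  have a1 := log_lem s (l + 1 / 2) hs0 (by rw [abs_of_pos (by linarith)]; linarith)
  have a2 := log_lem s (l - 1 / 2) hs0 (by rw [abs_of_pos (by linarith)]; linarith)
  have a3 := log_lem s (1 / 2) hs0 (by rw [abs_of_pos (by linarith)]; linarith)
  have e : LL l (m + 1) - LL l m =
      (Real.log (s + (l + 1 / 2)) - Real.log (s - (l + 1 / 2)) - 2 * (l + 1 / 2) / s)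
      + (Real.log (s + (l - 1 / 2)) - Real.log (s - (l - 1 / 2)) - 2 * (l - 1 / 2) / s)
      - 4 * l * (Real.log (s + 1 / 2) - Real.log (s - 1 / 2) - 2 * (1 / 2) / s) := by
    rw [LL, LL, geg_one_log_succ l hl]
    push_cast
    rw [show s + (l + 1 / 2) = m + 2 * l + 2 by rw [hs]; ring,
      show s - (l + 1 / 2) = m + 1 by rw [hs]; ring,
      show s + (l - 1 / 2) = m + (2 * l + 1) by rw [hs]; ring,
      show s - (l - 1 / 2) = m + 1 + 1 by rw [hs]; ring,
      show s + 1 / 2 = m + 1 + (l + 1) by rw [hs]; ring,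
      show s - 1 / 2 = m + (l + 1) by rw [hs]; ring,
      show (m:ℝ) + 1 + (2 * l + 1) = m + 2 * l + 2 by ring]
    ring
  have hD' : D / s ^ 3 ≤ D / ((m:ℝ) + 1) ^ 3 := by
    apply div_le_div_of_nonneg_left hD (by positivity)
    apply pow_le_pow_left₀ (by positivity); linarith
  refine le_trans ?_ hD'
  rw [e]
  have e4 : D / s ^ 3 = 4 * |l + 1 / 2| ^ 3 / s ^ 3 + 4 * |l - 1 / 2| ^ 3 / s ^ 3
      + 4 * l * (4 * |(1 / 2 : ℝ)| ^ 3 / s ^ 3) := by rw [hDd]; ring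
  rw [e4]
  refine (abs_sub _ _).trans (add_le_add ((abs_add_le _ _).trans (add_le_add a1 a2)) ?_)
  rw [abs_mul, abs_of_pos (by linarith : 0 < 4 * l)]
  exact mul_le_mul_of_nonneg_left a3 (by linarith)

lemma main_term (l : ℝ) (hl : 1 < l) : ∃ C : ℝ, 0 ≤ C ∧ ∃ N : ℕ, ∀ m : ℕ, N ≤ m →
    |(2 * l + 1) ^ 2 * gegenbauer (l + 1) m 1 ^ 2 / (((m : ℝ) + 1) * (m + (2 * l + 1)))
      * Real.Gamma (2 * l + 1) ^ 2
      - ((m : ℝ) + 2) ^ (4 * l) * (1 + 4 * l * ((l - 1) / (m + 2)))|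
     ≤ C * (((m : ℝ) + 2) ^ (4 * l) / (m + 2) ^ 2) := by
  obtain ⟨D, hD, N, hN⟩ := LL_bound l hl
  set E := 9 * D + 8 * l * (l - 1) ^ 2 with hE
  set F := E + 4 * l * (l - 1) with hF
  have hl1 : 0 < l - 1 := by linarith
  have hE0 : 0 ≤ E := by positivity
  have hF0 : 0 ≤ F := by positivity
  obtain ⟨N1, hN1⟩ := exists_nat_ge (F + 2 * (l - 1))
  refine ⟨F ^ 2 + E, by positivity, N + N1 + 1, fun m hm => ?_⟩
  have hL := hN m (by omega)
  have hmN : F + 2 * (l - 1) ≤ m := hN1.trans (by exact_mod_cast (by omega : N1 ≤ m))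
  have hm1 : (1:ℝ) ≤ m := by exact_mod_cast (by omega : 1 ≤ m)
  set n : ℝ := (m : ℝ) + 2 with hn
  have hn0 : 0 < n := by positivity
  set t := (l - 1) / n with ht
  have ht0 : 0 < t := by positivity
  have ht1 : t ≤ 1 / 2 := by rw [ht, div_le_iff₀ hn0]; linarith
  have hlog := Real.abs_log_sub_add_sum_range_le (x := -t) (by rw [abs_neg, abs_of_pos ht0]; linarith) 1
  simp only [Finset.sum_range_one, abs_neg, abs_of_pos ht0] at hlog
  have hlog2 : t ^ 2 / (1 - t) ≤ 2 * t ^ 2 := by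
    rw [div_le_iff₀ (by linarith)]; nlinarith [sq_nonneg t]
  have hlog3 : |Real.log (1 + t) - t| ≤ 2 * t ^ 2 := by
    refine le_trans (le_of_eq ?_) (hlog.trans hlog2)
    congr 1; simp; ring
  set z := LL l m + 4 * l * Real.log (1 + t) with hz
  have hLn : |LL l m| ≤ 9 * D / n ^ 2 := by
    refine hL.trans ?_
    rw [div_le_div_iff₀ (by positivity) (by positivity)]
    have : n ^ 2 ≤ 9 * (m:ℝ) ^ 2 := by
      have : n ≤ 3 * m := by linarith
      nlinarith
    nlinarith
  have hz1 : |z - 4 * l * t| ≤ E / n ^ 2 := by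
    have e : z - 4 * l * t = LL l m + 4 * l * (Real.log (1 + t) - t) := by rw [hz]; ring
    rw [e]
    refine (abs_add_le _ _).trans ?_
    rw [abs_mul, abs_of_pos (by linarith : 0 < 4 * l)]
    have h5 := mul_le_mul_of_nonneg_left hlog3 (by linarith : 0 ≤ 4 * l)
    have e2 : E / n ^ 2 = 9 * D / n ^ 2 + 4 * l * (2 * t ^ 2) := by rw [hE, ht]; field_simp; ring
    linarith
  have hz2 : |z| ≤ F / n := by
    have h6 : E / n ^ 2 ≤ E / n := by
      apply div_le_div_of_nonneg_left hE0 hn0; nlinarith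
    have h7 : |z| ≤ |z - 4 * l * t| + |4 * l * t| := by
      simpa using abs_add_le (z - 4 * l * t) (4 * l * t)
    rw [abs_of_pos (by positivity : 0 < 4 * l * t)] at h7
    have e3 : F / n = E / n + 4 * l * t := by rw [hF, ht]; ring
    linarith
  have hz3 : |z| ≤ 1 := hz2.trans (by rw [div_le_one hn0]; linarith)
  have hexp := Real.abs_exp_sub_one_sub_id_le hz3
  have hz4 : z ^ 2 ≤ F ^ 2 / n ^ 2 := by
    rw [← sq_abs, ← div_pow]; exact pow_le_pow_left₀ (abs_nonneg _) hz2 2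
  have hfin : |Real.exp z - (1 + 4 * l * t)| ≤ (F ^ 2 + E) / n ^ 2 := by
    have e : Real.exp z - (1 + 4 * l * t) = (Real.exp z - 1 - z) + (z - 4 * l * t) := by ring
    rw [e, add_div]
    exact (abs_add_le _ _).trans (add_le_add (hexp.trans hz4) hz1)
  have hY := geg_one_pos l hl m
  have hG : 0 < Real.Gamma (2 * l + 1) := Real.Gamma_pos_of_pos (by linarith)
  have hGs : Real.Gamma (2 * l + 2) = (2 * l + 1) * Real.Gamma (2 * l + 1) := by
    rw [← Real.Gamma_add_one (by linarith)]; congr 1; ring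
  have hT : (2 * l + 1) ^ 2 * gegenbauer (l + 1) m 1 ^ 2 / (((m : ℝ) + 1) * (m + (2 * l + 1)))
      * Real.Gamma (2 * l + 1) ^ 2 = n ^ (4 * l) * Real.exp z := by
    have hlogn : Real.log (m + (l + 1)) = Real.log n + Real.log (1 + t) := by
      rw [← Real.log_mul hn0.ne' (by positivity)]; congr 1; rw [ht]; field_simp; rw [hn]; ring
    have e1 : (2 * l + 1) ^ 2 * gegenbauer (l + 1) m 1 ^ 2 / (((m : ℝ) + 1) * (m + (2 * l + 1)))
      * Real.Gamma (2 * l + 1) ^ 2 = Real.Gamma (2 * l + 2) ^ 2 * gegenbauer (l + 1) m 1 ^ 2 /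
        (((m : ℝ) + 1) * (m + (2 * l + 1))) := by rw [hGs]; ring
    have hGs0 : 0 < Real.Gamma (2 * l + 2) := Real.Gamma_pos_of_pos (by linarith)
    rw [e1, Real.rpow_def_of_pos hn0, ← Real.exp_add, ← Real.exp_log (x := _ / _) (by positivity)]
    congr 1
    rw [Real.log_div (by positivity) (by positivity), Real.log_mul (by positivity) (by positivity),
      Real.log_mul (by positivity) (by positivity), Real.log_pow, Real.log_pow, hz, LL, hlogn]
    push_cast; ring
  rw [hT, ← mul_sub, abs_mul, abs_of_pos (by positivity : 0 < n ^ (4 * l))]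
  calc _ ≤ n ^ (4 * l) * ((F ^ 2 + E) / n ^ 2) := mul_le_mul_of_nonneg_left hfin (by positivity)
    _ = _ := by ring
lemma aux_J (l n : ℝ) (hl : 1 < l) (hn : 3 ≤ n) : n ^ 2 / 2 ≤ (n - 1) * (n + 2 * l - 1) ∧
    (n - 1) * (n + 2 * l - 1) ≤ (2 * l + 1) * n ^ 2 ∧ n ^ 2 / 3 ≤ (n - 2) * (n + 2 * l) ∧
    n + 2 * l - 1 ≤ (2 * l + 1) * n := by
  have h1 : n + 2 * l - 1 ≤ (2 * l + 1) * n := by nlinarith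
  refine ⟨by nlinarith, ?_, by nlinarith, h1⟩
  have := mul_le_mul (by linarith : n - 1 ≤ n) h1 (by linarith) (by linarith)
  linarith

set_option maxHeartbeats 2000000 in
theorem gegenbauer_L2_norm_asymptotic_large_lambda (lam : ℝ) (hlam : 1 < lam) :
    ∃ (C : ℝ) (N : ℕ), 0 < C ∧ ∀ n : ℕ, N ≤ n →
      |(∫ x in (0:ℝ)..1, (gegenbauer (lam + 1) (n - 2) x) ^ 2)
        - (n : ℝ) ^ (4 * lam) / (4 * lam * Real.Gamma (2 * lam + 1) ^ 2)
        - ((lam - 1) / Real.Gamma (2 * lam + 1) ^ 2) * (n : ℝ) ^ (4 * lam - 1)|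
      ≤ C * (n : ℝ) ^ (4 * lam - 2) := by
  obtain ⟨C1, hC1, N1, hmain⟩ := main_term lam hlam
  obtain ⟨Q, hQ0, hQ⟩ := qpoly_bound lam
  have hl0 : 0 < lam := by linarith
  have hl1 : 0 < lam - 1 := by linarith
  set G := Real.Gamma (2 * lam + 1) ^ 2 with hGd
  have hG : 0 < G := pow_pos (Real.Gamma_pos_of_pos (by linarith)) 2
  set κ := min 2 (4 * lam - 4) with hκd
  have hκ : 0 < κ := lt_min (by norm_num) (by linarith)
  obtain ⟨N2, hN2⟩ := exists_nat_ge (6 * Q / κ)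
  set ct := (1 + 4 * lam * (lam - 1) + C1) / G with hct
  have hct0 : 0 ≤ ct := by positivity
  set c3 := Q * ct + (2 * lam + 1) with hc3
  set b := (2 * lam + 1) ^ 2 + (2 * lam + 1) with hb
  have hb0 : 0 < b := by positivity
  have hc30 : 0 < c3 := by positivity
  refine ⟨6 * c3 / κ + 2 * b / (4 * lam) + C1 / (4 * lam * G) + 1, N1 + N2 + 3, by positivity, ?_⟩
  intro n' hn'
  obtain ⟨k, rfl⟩ : ∃ k, n' = k + 3 := ⟨n' - 3, by omega⟩
  have hm2 : k + 3 - 2 = k + 1 := by omega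
  rw [hm2]
  have hM := hmain (k + 1) (by omega)
  have hnN : 6 * Q / κ ≤ ((k + 3 : ℕ) : ℝ) := hN2.trans (by exact_mod_cast (by omega : N2 ≤ k + 3))
  set n : ℝ := ((k + 3 : ℕ) : ℝ) with hn
  have hnk : n = k + 3 := by rw [hn]; push_cast; ring
  have hk0 : (0:ℝ) ≤ k := Nat.cast_nonneg k
  have hn3 : 3 ≤ n := by linarith
  have hn0 : 0 < n := by linarith
  have hcast : ((k + 1 : ℕ) : ℝ) = n - 2 := by rw [hnk]; push_cast; ring
  rw [hcast] at hM
  rw [show n - 2 + 2 = n by ring, show n - 2 + 1 = n - 1 by ring,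
    show n - 2 + (2 * lam + 1) = n + 2 * lam - 1 by ring] at hM
  rw [Real.rpow_sub hn0, Real.rpow_sub hn0, Real.rpow_one, Real.rpow_two]
  set a := n ^ (4 * lam) with ha
  have ha0 : 0 < a := by positivity
  set y := gegenbauer (lam + 1) (k + 1) with hy
  set d := gegD (lam + 1) (k + 1) with hd
  set K : ℝ := ((k : ℝ) + 1) * (k + 1 + 2 * (lam + 1)) with hK
  have hK0 : 0 ≤ K := by positivity
  set J := (n - 1) * (n + 2 * lam - 1) with hJ
  have hKJ : K + 2 * lam + 1 = J := by rw [hK, hJ, hnk]; ring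
  obtain ⟨W, hP, hW, hPS, hSP⟩ := energy lam K y d (fun x => (geg_hasDerivAt (lam + 1) k x).2)
    (fun x => by
      have := geg_g_deriv (lam + 1) k x
      rwa [show 2 * (lam + 1) - 1 = 2 * lam + 1 by ring] at this) hK0 Q κ hQ
    (min_le_left _ _) (min_le_right _ _)
  rw [hKJ] at hP
  set S := ∫ x in (0:ℝ)..1, y x ^ 2
  set P := ∫ x in (0:ℝ)..1, x * y x ^ 2
  have h1n2 : 1 ≤ n ^ 2 := by nlinarith
  have hnn2 : n ≤ n ^ 2 := by nlinarith
  have hcn : (k:ℝ) + 1 + 2 = n := by rw [hnk]; ring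
  clear_value S P n a κ G ct c3 b y d K J
  have hJ2 : n ^ 2 / 2 ≤ J := by rw [hJ]; exact (aux_J lam n hlam hn3).1
  have hJ0 : 0 < J := lt_of_lt_of_le (by positivity) hJ2
  have hJu : J ≤ (2 * lam + 1) * n ^ 2 := by rw [hJ]; exact (aux_J lam n hlam hn3).2.1
  have hK3 : n ^ 2 / 3 ≤ K := by
    have e : K = (n - 2) * (n + 2 * lam) := by rw [hK, hnk]; ring
    rw [e]; exact (aux_J lam n hlam hn3).2.2.1
  -- values at zero
  set p := n ^ lam with hp
  have hp0 : 0 < p := by positivity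
  have hpa : n ^ 2 * p ^ 2 ≤ a := by
    have : n ^ 2 * p ^ 2 = n ^ (2 + 2 * lam) := by
      rw [Real.rpow_add hn0, Real.rpow_two, hp, mul_comm 2 lam, Real.rpow_mul hn0.le, Real.rpow_two]
    rw [this, ha]
    exact Real.rpow_le_rpow_of_exponent_le (by linarith) (by linarith)
  have hy0 : |y 0| ≤ p := by
    have := (geg_zero_bound lam hlam k).2
    rwa [hcn, ← hy] at this
  have hd0 : |d 0| ≤ (2 * lam + 1) * n * p := by
    have h1 := geg_g (lam + 1) k 0
    norm_num at h1
    have h2 : |gegenbauer (lam + 1) k 0| ≤ p := (geg_zero_bound lam hlam k).1.trans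
      (Real.rpow_le_rpow (by positivity) (by linarith) hl0.le)
    rw [hd, h1, abs_mul, abs_of_pos (by positivity)]
    apply mul_le_mul _ h2 (abs_nonneg _) (by positivity)
    have := (aux_J lam n hlam hn3).2.2.2
    linarith
  have hB : d 0 ^ 2 + J * y 0 ^ 2 ≤ b * a := by
    have h1 : d 0 ^ 2 ≤ ((2 * lam + 1) * n * p) ^ 2 := by
      rw [← sq_abs]; exact pow_le_pow_left₀ (abs_nonneg _) hd0 2
    have h2 : y 0 ^ 2 ≤ p ^ 2 := by
      rw [← sq_abs]; exact pow_le_pow_left₀ (abs_nonneg _) hy0 2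
    have h3 : J * y 0 ^ 2 ≤ ((2 * lam + 1) * n ^ 2) * p ^ 2 :=
      mul_le_mul hJu h2 (sq_nonneg _) (by positivity)
    have h4 := mul_le_mul_of_nonneg_left hpa hb0.le
    calc _ ≤ b * (n ^ 2 * p ^ 2) := by rw [hb]; linarith
      _ ≤ _ := h4
  have hyd : |y 0 * d 0| ≤ (2 * lam + 1) * a := by
    rw [abs_mul]
    have h1 := mul_le_mul hy0 hd0 (abs_nonneg _) hp0.le
    have h2 : n * p ^ 2 ≤ n ^ 2 * p ^ 2 :=
      mul_le_mul_of_nonneg_right hnn2 (by positivity)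
    have h3 := mul_le_mul_of_nonneg_left (h2.trans hpa) (by positivity : 0 ≤ 2 * lam + 1)
    linarith
  have hB0 : 0 ≤ d 0 ^ 2 + J * y 0 ^ 2 := by positivity
  set B := d 0 ^ 2 + J * y 0 ^ 2
  clear_value B
  set T := (2 * lam + 1) ^ 2 * y 1 ^ 2 / J with hT
  have hTJ : (2 * lam + 1) ^ 2 * y 1 ^ 2 = T * J := by rw [hT]; field_simp
  have hT0 : 0 ≤ T := by positivity
  have hPe : P = T / (4 * lam) - B / (4 * lam * J) := by
    rw [hTJ] at hP; field_simp; linarith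
  clear_value T
  have ha2 : a / n ^ 2 ≤ a := div_le_self ha0.le h1n2
  have hTa : T ≤ ct * a := by
    have h1 := (abs_le.1 hM).2
    have h2 : a * (1 + 4 * lam * ((lam - 1) / n)) ≤ a * (1 + 4 * lam * (lam - 1)) := by
      have : (lam - 1) / n ≤ lam - 1 := div_le_self hl1.le (by linarith)
      gcongr
    have h3 := mul_le_mul_of_nonneg_left ha2 hC1
    rw [hct, div_mul_eq_mul_div, le_div_iff₀ hG]
    linarith
  have hPa : P ≤ ct * a := by
    have h1 : 0 ≤ B / (4 * lam * J) := by positivity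
    have h2 : T / (4 * lam) ≤ T := div_le_self hT0 (by linarith)
    linarith
  have hW0 : 0 ≤ W := by linarith
  have hWb : W ≤ 6 * c3 / κ * (a / n ^ 2) := by
    have h1 : Q ≤ n ^ 2 * κ / 6 := by
      rw [div_le_iff₀ hκ] at hnN
      have h7 := mul_le_mul_of_nonneg_right hnn2 hκ.le
      linarith
    have h2 : Q * S ≤ Q * (ct * a + W) := mul_le_mul_of_nonneg_left (by linarith) hQ0
    have h3 : n ^ 2 / 3 * (κ * W) ≤ K * (κ * W) := mul_le_mul_of_nonneg_right hK3 (by positivity)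
    have h4 : Q * W ≤ n ^ 2 * κ / 6 * W := mul_le_mul_of_nonneg_right h1 hW0
    have h5 : n ^ 2 * κ * W ≤ 6 * (c3 * a) := by rw [hc3]; linarith
    rw [div_mul_div_comm, le_div_iff₀ (by positivity)]
    linarith
  have hBJ : B / (4 * lam * J) ≤ 2 * b / (4 * lam) * (a / n ^ 2) := by
    rw [div_mul_div_comm, div_le_div_iff₀ (by positivity) (by positivity)]
    have h1 : B * n ^ 2 ≤ (b * a) * (2 * J) := mul_le_mul hB (by linarith) (by positivity) (by positivity)
    have h2 := mul_le_mul_of_nonneg_left h1 (by positivity : 0 ≤ 4 * lam)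
    linarith
  have hBJ0 : 0 ≤ B / (4 * lam * J) := by positivity
  have hid : S - a / (4 * lam * G) - (lam - 1) / G * (a / n)
      = (S - P) - B / (4 * lam * J) + (T * G - a * (1 + 4 * lam * ((lam - 1) / n))) / (4 * lam * G) := by
    rw [hPe]; field_simp; ring
  rw [hid]
  have h3 : |(T * G - a * (1 + 4 * lam * ((lam - 1) / n))) / (4 * lam * G)|
      ≤ C1 / (4 * lam * G) * (a / n ^ 2) := by
    rw [abs_div, abs_of_pos (by positivity : 0 < 4 * lam * G), div_mul_eq_mul_div]
    exact div_le_div_of_nonneg_right hM (by positivity : 0 ≤ 4 * lam * G)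
  have h3' := abs_le.1 h3
  have h4 : 0 < a / n ^ 2 := by positivity
  have h5 : 0 ≤ 6 * c3 / κ * (a / n ^ 2) := by positivity
  have h6 : 0 ≤ 2 * b / (4 * lam) * (a / n ^ 2) := by positivity
  rw [abs_le]
  constructor <;> linarith [h3'.1, h3'.2]
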